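/- If an NRTSS R over a nominal residual signature Σ is in equivariant format (i.e. (a b)·Ru ∈ R for every rule Ru ∈ R and all atoms a, b), then the transition relation induced by R is equivariant: if ⟦p⟧ → ⟦p'⟧ is provable in R then π·⟦p⟧ → π·⟦p'⟧ is provable in R for every finite permutation π; hence R induces a nominal residual transition system. -/

import Mathlib

universe u v w y

/-- The subgroup of finite permutations of the set `𝔸` of atoms. -/
def finPerms (𝔸 : Type u) : Subgroup (Equiv.Perm 𝔸) where
  carrier := {π | {a | π a ≠ a}.Finite}
  one_mem' := by
    show {a : 𝔸 | (1 : Equiv.Perm 𝔸) a ≠ a}.Finite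
    simp
  mul_mem' := by
    intro π₁ π₂ h₁ h₂
    show {a : 𝔸 | (π₁ * π₂) a ≠ a}.Finite
    apply Set.Finite.subset (Set.Finite.union h₁ h₂)
    intro a ha
    simp only [Set.mem_setOf_eq, Equiv.Perm.mul_apply] at ha
    by_contra hc
    simp only [Set.mem_union, Set.mem_setOf_eq, not_or, not_not] at hc
    rw [hc.2, hc.1] at ha
    exact ha rfl
  inv_mem' := by
    intro π h
    show {a : 𝔸 | π⁻¹ a ≠ a}.Finite
    have e : {a : 𝔸 | π⁻¹ a ≠ a} = {a : 𝔸 | π a ≠ a} := by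
      ext a
      simp only [Set.mem_setOf_eq, ne_eq, Equiv.Perm.inv_eq_iff_eq]
      exact ⟨fun h' h'' => h' h''.symm, fun h' h'' => h' h''.symm⟩
    exact e ▸ h

/-- The group of finite permutations of atoms. -/
abbrev FinPerm (𝔸 : Type u) := ↥(finPerms 𝔸)

/-- The transposition `(a b)` as a finite permutation. -/
def swapF {𝔸 : Type u} [DecidableEq 𝔸] (a b : 𝔸) : FinPerm 𝔸 :=
  ⟨Equiv.swap a b, by
    show {x : 𝔸 | Equiv.swap a b x ≠ x}.Finite
    apply Set.Finite.subset ((Set.finite_singleton b).insert a)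
    intro x hx
    simp only [Set.mem_setOf_eq] at hx
    by_contra hc
    simp only [Set.mem_insert_iff, Set.mem_singleton_iff, not_or] at hc
    exact hx (Equiv.swap_apply_of_ne_of_ne hc.1 hc.2)⟩

/-- `A` supports `x`: every finite permutation fixing `A` pointwise fixes `x`. -/
def NSupports {𝔸 : Type u} {X : Type v} [SMul (FinPerm 𝔸) X] (A : Set 𝔸) (x : X) : Prop :=
  ∀ π : FinPerm 𝔸, (∀ a ∈ A, π.val a = a) → π • x = x

/-- The support of `x`: the intersection of all finite supporting sets. -/
def nsupp (𝔸 : Type u) {X : Type v} [SMul (FinPerm 𝔸) X] (x : X) : Set 𝔸 :=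
  ⋂₀ {A : Set 𝔸 | A.Finite ∧ NSupports A x}

/-- `a` is fresh in `x`. -/
def nfresh {𝔸 : Type u} {X : Type v} [SMul (FinPerm 𝔸) X] (a : 𝔸) (x : X) : Prop :=
  a ∉ nsupp 𝔸 x

/-- A `FinPerm 𝔸`-set is nominal when every element has a finite supporting set. -/
def IsNominal (𝔸 : Type u) (X : Type v) [SMul (FinPerm 𝔸) X] : Prop :=
  ∀ x : X, ∃ A : Set 𝔸, A.Finite ∧ NSupports A x



/-- Raw terms over a nominal signature: variables, atoms, moderated terms (delayed
renamings), atom abstractions, tuples and function-symbol applications. -/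
inductive Raw (𝔸 : Type u) (V : Type v) (F : Type w) : Type (max u v w) where
  | var : V → Raw 𝔸 V F
  | atom : 𝔸 → Raw 𝔸 V F
  | mod : Raw 𝔸 V F → (𝔸 → 𝔸) → Raw 𝔸 V F
  | abs : 𝔸 → Raw 𝔸 V F → Raw 𝔸 V F
  | tuple : List (Raw 𝔸 V F) → Raw 𝔸 V F
  | app : F → Raw 𝔸 V F → Raw 𝔸 V F

variable {𝔸 : Type u} {V : Type v} {F : Type w}

mutual
  /-- The action of a renaming on a raw term, `t{ρ}`. -/
  def Raw.ren : Raw 𝔸 V F → (𝔸 → 𝔸) → Raw 𝔸 V F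
    | .var x, _ => .var x
    | .atom a, ρ => .atom (ρ a)
    | .mod t ρ₁, ρ => .mod t (ρ ∘ ρ₁)
    | .abs a t, ρ => .abs (ρ a) (t.ren ρ)
    | .tuple ts, ρ => .tuple (Raw.renList ts ρ)
    | .app f t, ρ => .app f (t.ren ρ)
  def Raw.renList : List (Raw 𝔸 V F) → (𝔸 → 𝔸) → List (Raw 𝔸 V F)
    | [], _ => []
    | t :: ts, ρ => t.ren ρ :: Raw.renList ts ρ
end

mutual
  /-- The action of a permutation on a raw term, `π · t`. -/
  def Raw.perm : Raw 𝔸 V F → Equiv.Perm 𝔸 → Raw 𝔸 V F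
    | .var x, _ => .var x
    | .atom a, π => .atom (π a)
    | .mod t ρ, π => .mod (t.perm π) (π ∘ ρ ∘ π.symm)
    | .abs a t, π => .abs (π a) (t.perm π)
    | .tuple ts, π => .tuple (Raw.permList ts π)
    | .app f t, π => .app f (t.perm π)
  def Raw.permList : List (Raw 𝔸 V F) → Equiv.Perm 𝔸 → List (Raw 𝔸 V F)
    | [], _ => []
    | t :: ts, π => t.perm π :: Raw.permList ts π
end

mutual
  /-- The set of variables occurring in a raw term. -/
  def Raw.vars : Raw 𝔸 V F → Set V
    | .var x => {x}
    | .atom _ => ∅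
    | .mod t _ => t.vars
    | .abs _ t => t.vars
    | .tuple ts => Raw.varsList ts
    | .app _ t => t.vars
  def Raw.varsList : List (Raw 𝔸 V F) → Set V
    | [] => ∅
    | t :: ts => t.vars ∪ Raw.varsList ts
end

/-- The support of a renaming. -/
def renSupp (ρ : 𝔸 → 𝔸) : Set 𝔸 := {a | ρ a ≠ a} ∪ ρ '' {a | ρ a ≠ a}

mutual
  /-- The support of a raw term. -/
  def Raw.supp : Raw 𝔸 V F → Set 𝔸
    | .var _ => ∅
    | .atom a => {a}
    | .mod t ρ => t.supp ∪ renSupp ρ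
    | .abs a t => {a} ∪ t.supp
    | .tuple ts => Raw.suppList ts
    | .app _ t => t.supp
  def Raw.suppList : List (Raw 𝔸 V F) → Set 𝔸
    | [] => ∅
    | t :: ts => t.supp ∪ Raw.suppList ts
end

mutual
  /-- The size of a raw term. -/
  def Raw.size : Raw 𝔸 V F → ℕ
    | .var _ => 1
    | .atom _ => 1
    | .mod t _ => t.size + 1
    | .abs _ t => t.size + 1
    | .tuple ts => Raw.sizeList ts + 1
    | .app _ t => t.size + 1
  def Raw.sizeList : List (Raw 𝔸 V F) → ℕ
    | [] => 0
    | t :: ts => t.size + Raw.sizeList ts + 1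
end

mutual
  theorem Raw.size_ren : ∀ (t : Raw 𝔸 V F) (ρ : 𝔸 → 𝔸), (t.ren ρ).size = t.size
    | .var _, _ => rfl
    | .atom _, _ => rfl
    | .mod _ _, _ => rfl
    | .abs a t, ρ => by simp only [Raw.ren, Raw.size, Raw.size_ren t ρ]
    | .tuple ts, ρ => by simp only [Raw.ren, Raw.size, Raw.sizeList_renList ts ρ]
    | .app f t, ρ => by simp only [Raw.ren, Raw.size, Raw.size_ren t ρ]
  theorem Raw.sizeList_renList :
      ∀ (ts : List (Raw 𝔸 V F)) (ρ : 𝔸 → 𝔸), Raw.sizeList (Raw.renList ts ρ) = Raw.sizeList ts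
    | [], _ => rfl
    | t :: ts, ρ => by
        simp only [Raw.renList, Raw.sizeList, Raw.size_ren t ρ, Raw.sizeList_renList ts ρ]
end

mutual
  /-- The set of free atoms of a raw term. -/
  def Raw.fa : Raw 𝔸 V F → Set 𝔸
    | .var _ => ∅
    | .atom a => {a}
    | .mod t ρ => (t.ren ρ).fa
    | .abs a t => t.fa \ {a}
    | .tuple ts => Raw.faList ts
    | .app _ t => t.fa
  termination_by t => t.size
  decreasing_by all_goals (simp [Raw.size, Raw.sizeList, Raw.size_ren] <;> omega)
  def Raw.faList : List (Raw 𝔸 V F) → Set 𝔸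
    | [] => ∅
    | t :: ts => t.fa ∪ Raw.faList ts
  termination_by ts => Raw.sizeList ts
  decreasing_by all_goals (simp [Raw.size, Raw.sizeList, Raw.size_ren] <;> omega)
end

mutual
  /-- Extension of a substitution to raw terms. -/
  def Raw.subst : Raw 𝔸 V F → (V → Raw 𝔸 V F) → Raw 𝔸 V F
    | .var x, φ => φ x
    | .atom a, _ => .atom a
    | .mod t ρ, φ => .mod (t.subst φ) ρ
    | .abs a t, φ => .abs a (t.subst φ)
    | .tuple ts, φ => .tuple (Raw.substList ts φ)
    | .app f t, φ => .app f (t.subst φ)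
  def Raw.substList : List (Raw 𝔸 V F) → (V → Raw 𝔸 V F) → List (Raw 𝔸 V F)
    | [], _ => []
    | t :: ts, φ => t.subst φ :: Raw.substList ts φ
end

/-- A Σ-structure: a `FinPerm`-set together with equivariant interpretations of
atoms, atom abstraction, tupling and the function symbols. -/
structure SigmaStr (𝔸 : Type u) (V : Type v) (F : Type w) (X : Type y)
    [MulAction (FinPerm 𝔸) X] where
  iatom : 𝔸 → X
  iabs : 𝔸 → X → X
  ituple : List X → X
  ifun : F → X → X
  iatom_eqv : ∀ (π : FinPerm 𝔸) (a : 𝔸), π • iatom a = iatom (π.val a)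
  iabs_eqv : ∀ (π : FinPerm 𝔸) (a : 𝔸) (x : X), π • iabs a x = iabs (π.val a) (π • x)
  ituple_eqv : ∀ (π : FinPerm 𝔸) (xs : List X),
    π • ituple xs = ituple (xs.map (fun x => π • x))
  ifun_eqv : ∀ (π : FinPerm 𝔸) (f : F) (x : X), π • ifun f x = ifun f (π • x)

variable {X : Type y} [MulAction (FinPerm 𝔸) X]

mutual
  /-- The interpretation of a (ground) raw term in a Σ-structure. -/
  def interp (M : SigmaStr 𝔸 V F X) : Raw 𝔸 V F → X
    | .var _ => M.ituple []
    | .atom a => M.iatom a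
    | .mod t ρ => interp M (t.ren ρ)
    | .abs a t => M.iabs a (interp M t)
    | .tuple ts => M.ituple (interpList M ts)
    | .app f t => M.ifun f (interp M t)
  termination_by t => t.size
  decreasing_by all_goals (simp [Raw.size, Raw.sizeList, Raw.size_ren] <;> omega)
  /-- The interpretation of a list of raw terms in a Σ-structure. -/
  def interpList (M : SigmaStr 𝔸 V F X) : List (Raw 𝔸 V F) → List X
    | [] => []
    | t :: ts => interp M t :: interpList M ts
  termination_by ts => Raw.sizeList ts
  decreasing_by all_goals (simp [Raw.size, Raw.sizeList, Raw.size_ren] <;> omega)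
end

/-- The characteristic properties of the Σ-structure `NT` of nominal terms:
a Σ-structure which is nominal and in which atoms, abstraction, tupling and the
(injective) function symbols have the expected supports, and in which atom
abstraction identifies alpha-equivalent pairs. -/
structure NTModel (𝔸 : Type u) (V : Type v) (F : Type w) (X : Type y) [DecidableEq 𝔸]
    [MulAction (FinPerm 𝔸) X] extends SigmaStr 𝔸 V F X where
  nominal : IsNominal 𝔸 X
  supp_iatom : ∀ a : 𝔸, nsupp 𝔸 (iatom a) = {a}
  supp_iabs : ∀ (a : 𝔸) (x : X), nsupp 𝔸 (iabs a x) = nsupp 𝔸 x \ {a}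
  supp_ituple : ∀ xs : List X, nsupp 𝔸 (ituple xs) = ⋃ x ∈ xs, nsupp 𝔸 x
  supp_ifun : ∀ (f : F) (x : X), nsupp 𝔸 (ifun f x) = nsupp 𝔸 x
  iabs_alpha : ∀ (a b : 𝔸) (x : X), b = a ∨ nfresh b x → iabs a x = iabs b (swapF a b • x)
  iabs_inj : ∀ (a : 𝔸) (x y : X), iabs a x = iabs a y → x = y
  ituple_inj : ∀ xs ys : List X, ituple xs = ituple ys → xs = ys
  ifun_inj : ∀ (f : F) (x y : X), ifun f x = ifun f y → x = y

/-- A freshness assertion `a ⋦ t`. -/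
abbrev Assn (𝔸 : Type u) (V : Type v) (F : Type w) := 𝔸 × Raw 𝔸 V F

/-- A transition rule of an NRTSS: a set of premisses `uᵢ → u'ᵢ`, a freshness
environment, and a conclusion `src → tgt`. -/
structure NRule (𝔸 : Type u) (V : Type v) (F : Type w) where
  prem : Set (Raw 𝔸 V F × Raw 𝔸 V F)
  env : Set (Assn 𝔸 V F)
  src : Raw 𝔸 V F
  tgt : Raw 𝔸 V F

/-- The action of a permutation on a freshness assertion. -/
def permAssn {𝔸 : Type u} {V : Type v} {F : Type w} (π : Equiv.Perm 𝔸)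
    (e : Assn 𝔸 V F) : Assn 𝔸 V F :=
  (π e.1, Raw.perm e.2 π)

/-- The (componentwise) action of a permutation on a transition rule. -/
def permNRule {𝔸 : Type u} {V : Type v} {F : Type w} (π : Equiv.Perm 𝔸)
    (ru : NRule 𝔸 V F) : NRule 𝔸 V F where
  prem := (fun pr => (Raw.perm pr.1 π, Raw.perm pr.2 π)) '' ru.prem
  env := permAssn π '' ru.env
  src := Raw.perm ru.src π
  tgt := Raw.perm ru.tgt π

/-- A substitution is ground iff it maps every variable to a ground term. -/
def GroundSubst {𝔸 : Type u} {V : Type v} {F : Type w} (φ : V → Raw 𝔸 V F) : Prop :=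
  ∀ x : V, Raw.vars (φ x) = ∅

/-- A rule has a finitely supported set of premisses. -/
def FinSuppPrem {𝔸 : Type u} {V : Type v} {F : Type w} (ru : NRule 𝔸 V F) : Prop :=
  ∃ A : Set 𝔸, A.Finite ∧ ∀ π : FinPerm 𝔸, (∀ a ∈ A, π.val a = a) →
    (fun pr : Raw 𝔸 V F × Raw 𝔸 V F => (Raw.perm pr.1 π.val, Raw.perm pr.2 π.val)) ''
      ru.prem = ru.prem

/-- Provability of a transition between nominal terms in an NRTSS, by means of a
well-founded proof tree: each node is obtained from a rule of `R` and a ground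
substitution `φ` such that the node is the `φ`-instance of the conclusion, its
children are the `φ`-instances of the premisses, and the `φ`-instance of the
freshness environment holds. -/
inductive Provable {𝔸 : Type u} {V : Type v} {F : Type w} {X : Type y}
    [MulAction (FinPerm 𝔸) X] (M : SigmaStr 𝔸 V F X) (R : Set (NRule 𝔸 V F)) :
    X → X → Prop where
  | step (ru : NRule 𝔸 V F) (φ : V → Raw 𝔸 V F)
      (hru : ru ∈ R) (hφ : GroundSubst φ)
      (hprem : ∀ pr ∈ ru.prem,
        Provable M R (interp M (Raw.subst pr.1 φ)) (interp M (Raw.subst pr.2 φ)))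
      (henv : ∀ e ∈ ru.env, nfresh e.1 (interp M (Raw.subst e.2 φ))) :
      Provable M R (interp M (Raw.subst ru.src φ)) (interp M (Raw.subst ru.tgt φ))

/-!
STATEMENT 8: If an NRTSS R over a nominal residual signature Σ is in equivariant
format (i.e. (a b)·Ru ∈ R for every rule Ru ∈ R and all atoms a, b), then the
transition relation induced by R is equivariant: if ⟦p⟧ → ⟦p'⟧ is provable in R
then π·⟦p⟧ → π·⟦p'⟧ is provable in R for every finite permutation π; hence R
induces a nominal residual transition system.
-/


mutual
  theorem Raw.perm_ren' (π : Equiv.Perm 𝔸) : ∀ (t : Raw 𝔸 V F) (ρ : 𝔸 → 𝔸),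
      (t.ren ρ).perm π = (t.perm π).ren (π ∘ ρ ∘ π.symm)
    | .var _, _ => by simp only [Raw.ren, Raw.perm]
    | .atom _, _ => by simp [Raw.ren, Raw.perm]
    | .mod t ρ₁, ρ => by
        simp only [Raw.ren, Raw.perm]
        congr 1
        funext x
        simp
    | .abs a t, ρ => by simp [Raw.ren, Raw.perm, Raw.perm_ren' π t ρ]
    | .tuple ts, ρ => by simp only [Raw.ren, Raw.perm, Raw.permList_renList' π ts ρ]
    | .app f t, ρ => by simp only [Raw.ren, Raw.perm, Raw.perm_ren' π t ρ]
  theorem Raw.permList_renList' (π : Equiv.Perm 𝔸) : ∀ (ts : List (Raw 𝔸 V F)) (ρ : 𝔸 → 𝔸),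
      Raw.permList (Raw.renList ts ρ) π = Raw.renList (Raw.permList ts π) (π ∘ ρ ∘ π.symm)
    | [], _ => by simp only [Raw.renList, Raw.permList]
    | t :: ts, ρ => by
        simp only [Raw.renList, Raw.permList, Raw.perm_ren' π t ρ, Raw.permList_renList' π ts ρ]
end

mutual
  theorem Raw.perm_subst' (π : Equiv.Perm 𝔸) (φ : V → Raw 𝔸 V F) : ∀ (t : Raw 𝔸 V F),
      (t.subst φ).perm π = (t.perm π).subst (fun x => (φ x).perm π)
    | .var _ => by simp only [Raw.subst, Raw.perm]
    | .atom _ => by simp only [Raw.subst, Raw.perm]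
    | .mod t ρ₁ => by simp only [Raw.subst, Raw.perm, Raw.perm_subst' π φ t]
    | .abs a t => by simp only [Raw.subst, Raw.perm, Raw.perm_subst' π φ t]
    | .tuple ts => by simp only [Raw.subst, Raw.perm, Raw.permList_substList' π φ ts]
    | .app f t => by simp only [Raw.subst, Raw.perm, Raw.perm_subst' π φ t]
  theorem Raw.permList_substList' (π : Equiv.Perm 𝔸) (φ : V → Raw 𝔸 V F) :
      ∀ (ts : List (Raw 𝔸 V F)),
      Raw.permList (Raw.substList ts φ) π =
        Raw.substList (Raw.permList ts π) (fun x => (φ x).perm π)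
    | [] => by simp only [Raw.substList, Raw.permList]
    | t :: ts => by
        simp only [Raw.substList, Raw.permList, Raw.perm_subst' π φ t,
          Raw.permList_substList' π φ ts]
end

mutual
  theorem Raw.vars_perm' (π : Equiv.Perm 𝔸) : ∀ (t : Raw 𝔸 V F), (t.perm π).vars = t.vars
    | .var _ => by simp only [Raw.perm]
    | .atom _ => by simp only [Raw.vars, Raw.perm]
    | .mod t ρ₁ => by simp only [Raw.vars, Raw.perm, Raw.vars_perm' π t]
    | .abs a t => by simp only [Raw.vars, Raw.perm, Raw.vars_perm' π t]
    | .tuple ts => by simp only [Raw.vars, Raw.perm, Raw.varsList_permList' π ts]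
    | .app f t => by simp only [Raw.vars, Raw.perm, Raw.vars_perm' π t]
  theorem Raw.varsList_permList' (π : Equiv.Perm 𝔸) : ∀ (ts : List (Raw 𝔸 V F)),
      Raw.varsList (Raw.permList ts π) = Raw.varsList ts
    | [] => by simp only [Raw.permList]
    | t :: ts => by
        simp only [Raw.varsList, Raw.permList, Raw.vars_perm' π t, Raw.varsList_permList' π ts]
end

mutual
  theorem interp_perm' (M : SigmaStr 𝔸 V F X) (π : FinPerm 𝔸) : ∀ (t : Raw 𝔸 V F),
      interp M (t.perm π.val) = π • interp M t
    | .var _ => by simp [Raw.perm, interp, M.ituple_eqv]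
    | .atom _ => by simp only [Raw.perm, interp, M.iatom_eqv]
    | .mod t ρ₁ => by
        simp only [Raw.perm, interp]
        rw [← Raw.perm_ren', interp_perm' M π (t.ren ρ₁)]
    | .abs a t => by simp only [Raw.perm, interp, M.iabs_eqv, interp_perm' M π t]
    | .tuple ts => by simp only [Raw.perm, interp, M.ituple_eqv, interpList_perm' M π ts]
    | .app f t => by simp only [Raw.perm, interp, M.ifun_eqv, interp_perm' M π t]
  termination_by t => t.size
  decreasing_by all_goals (simp [Raw.size, Raw.sizeList, Raw.size_ren] <;> omega)
  theorem interpList_perm' (M : SigmaStr 𝔸 V F X) (π : FinPerm 𝔸) : ∀ (ts : List (Raw 𝔸 V F)),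
      interpList M (Raw.permList ts π.val) = (interpList M ts).map (fun x => π • x)
    | [] => by simp [Raw.permList, interpList]
    | t :: ts => by
        simp only [Raw.permList, interpList, List.map_cons, interp_perm' M π t,
          interpList_perm' M π ts]
  termination_by ts => Raw.sizeList ts
  decreasing_by all_goals (simp [Raw.size, Raw.sizeList, Raw.size_ren] <;> omega)
end

theorem nfresh_smul' (π : FinPerm 𝔸) (a : 𝔸) (x : X) (h : nfresh a x) :
    nfresh (π.val a) (π • x) := by
  unfold nfresh nsupp at *
  simp only [Set.mem_sInter, Set.mem_setOf_eq, not_forall] at *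
  obtain ⟨A, ⟨hA, hs⟩, ha⟩ := h
  refine ⟨π.val '' A, ⟨hA.image _, ?_⟩, ?_⟩
  · intro σ hσ
    have h1 := hs (π⁻¹ * σ * π) (by
      intro b hb
      have h2 := hσ (π.val b) ⟨b, hb, rfl⟩
      simp [Equiv.Perm.mul_apply, h2])
    rw [mul_smul, mul_smul, inv_smul_eq_iff] at h1
    exact h1
  · rintro ⟨b, hb, e⟩
    exact ha (π.val.injective e ▸ hb)

theorem provable_smul' (M : SigmaStr 𝔸 V F X) (R : Set (NRule 𝔸 V F)) (π : FinPerm 𝔸)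
    (hπ : ∀ ru ∈ R, permNRule π.val ru ∈ R) (p r : X) (h : Provable M R p r) :
    Provable M R (π • p) (π • r) := by
  induction h with
  | step ru φ hru hφ hprem henv ih =>
    have key : ∀ t : Raw 𝔸 V F, interp M ((t.perm π.val).subst (fun x => (φ x).perm π.val)) =
        π • interp M (t.subst φ) := by
      intro t
      rw [← Raw.perm_subst', interp_perm']
    have := Provable.step (M := M) (permNRule π.val ru) (fun x => (φ x).perm π.val)
      (hπ ru hru) (fun x => by rw [Raw.vars_perm']; exact hφ x)
      (by
        rintro _ ⟨pr, hpr, rfl⟩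
        simp only [key]
        exact ih pr hpr)
      (by
        rintro _ ⟨e, he, rfl⟩
        simp only [permAssn, key]
        exact nfresh_smul' π _ _ (henv e he))
    simpa only [permNRule, key] using this

theorem stmt8 {𝔸 : Type u} {V : Type v} {F : Type w} {X : Type y}
    [DecidableEq 𝔸] [Countable 𝔸] [Infinite 𝔸] [MulAction (FinPerm 𝔸) X]
    (M : NTModel 𝔸 V F X) (R : Set (NRule 𝔸 V F))
    (hwf : ∀ ru ∈ R, FinSuppPrem ru ∧ ru.env.Finite)
    (hfmt : ∀ ru ∈ R, ∀ a b : 𝔸, permNRule (Equiv.swap a b) ru ∈ R) :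
    ∀ p r : X, Provable M.toSigmaStr R p r →
      ∀ π : FinPerm 𝔸, Provable M.toSigmaStr R (π • p) (π • r) := by
  have hswap : ∀ a b : 𝔸, ∀ p r, Provable M.toSigmaStr R p r →
      Provable M.toSigmaStr R (swapF a b • p) (swapF a b • r) := fun a b p r h =>
    provable_smul' M.toSigmaStr R (swapF a b) (fun ru hru => hfmt ru hru a b) p r h
  have hsq : ∀ a b : 𝔸, swapF a b * swapF a b = 1 := fun a b =>
    Subtype.ext (Equiv.swap_mul_self a b)
  have main : ∀ f ∈ Subgroup.closure {σ : Equiv.Perm 𝔸 | σ.IsSwap},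
      ∃ h : f ∈ finPerms 𝔸, ∀ p r, Provable M.toSigmaStr R p r ↔
        Provable M.toSigmaStr R ((⟨f, h⟩ : FinPerm 𝔸) • p) ((⟨f, h⟩ : FinPerm 𝔸) • r) := by
    intro f hf
    induction hf using Subgroup.closure_induction with
    | mem f hf =>
      obtain ⟨a, b, -, rfl⟩ := hf
      refine ⟨(swapF a b).2, fun p r => ⟨hswap a b p r, fun h => ?_⟩⟩
      have h' := hswap a b _ _ h
      change Provable _ _ (swapF a b • swapF a b • p) (swapF a b • swapF a b • r) at h'
      rwa [← mul_smul, ← mul_smul, hsq, one_smul, one_smul] at h'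
    | one =>
      refine ⟨one_mem _, fun p r => ?_⟩
      change _ ↔ Provable _ _ ((1 : FinPerm 𝔸) • p) ((1 : FinPerm 𝔸) • r)
      rw [one_smul, one_smul]
    | mul f g _ _ hf hg =>
      obtain ⟨h1, h2⟩ := hf
      obtain ⟨h3, h4⟩ := hg
      refine ⟨mul_mem h1 h3, fun p r => ?_⟩
      rw [h4, h2, ← mul_smul, ← mul_smul]
      rfl
    | inv f _ hf =>
      obtain ⟨h1, h2⟩ := hf
      refine ⟨inv_mem h1, fun p r => ?_⟩
      change _ ↔ Provable _ _ ((⟨f, h1⟩ : FinPerm 𝔸)⁻¹ • p) ((⟨f, h1⟩ : FinPerm 𝔸)⁻¹ • r)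
      rw [h2 (_ • p), smul_inv_smul, smul_inv_smul]
  intro p r h π
  obtain ⟨_, h2⟩ := main π.val (mem_closure_isSwap'.2 π.2)
  exact (h2 p r).1 h
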